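/- Let k ≥ 0, ℓ ≥ 1, λ ∈ P_ℓ^k, z an integer with 1 ≤ z ≤ bot_λ, and a ≥ 1 an integer such that down_λ^{a−1}(z) ∈ [1, bot_λ] and d := down_λ^a(z) ∈ [bot_λ + 1, ℓ]. Suppose γ := λ − ε_d ∉ P_ℓ^k (equivalently d < ℓ and λ_d = λ_{d+1}), and suppose moreover that λ_z > λ_{z+1} in case down_λ^{a−1}(z) ∈ [1, bot_λ − 1]. Then K(Δ^k(λ); M_z(λ); λ − ε_d) = 0. -/

import Mathlib

open scoped Classical

noncomputable section

/-- The ambient ring: formal power series over ℚ in countably many variables. -/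
abbrev R : Type := MvPowerSeries ℕ ℚ

/-- The complete homogeneous symmetric function `h_m` (equal to `0` for `m < 0`):
its coefficient at a monomial is `1` if the monomial has total degree `m`, else `0`. -/
def hh (m : ℤ) : R := fun d => if ((d.sum fun _ e => (e : ℤ)) = m) then 1 else 0

/-- The inhomogeneous analogue `k_m^{(r)} = ∑_{i=0}^{m} C(r+i−1, i) · h_{m−i}`. -/
def kk (r : ℕ) (m : ℤ) : R :=
  ∑ i ∈ Finset.range (m.toNat + 1), ((r + i - 1).choose i : ℚ) • hh (m - (i : ℤ))

/-- The dual stable Grothendieck polynomial `g_γ`, as an `ℓ × ℓ` determinant with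
`(i,j)` entry `k_{γ_i + j − i}^{(i−1)}` (indices 1-based). -/
def gg (ℓ : ℕ) (γ : ℕ → ℤ) : R :=
  (Matrix.of fun i j : Fin ℓ =>
    kk i.val (γ (i.val + 1) + (j.val : ℤ) - (i.val : ℤ))).det

/-- The `i`-th standard basis vector `ε_i`. -/
def eps (i : ℕ) : ℕ → ℤ := fun x => if x = i then 1 else 0

/-- The Katalan function `K(Ψ; M; γ)`. -/
def katalan (ℓ : ℕ) (Ψ : Finset (ℕ × ℕ)) (M : Multiset ℕ) (γ : ℕ → ℤ) : R :=
  (M.powerset.map fun S =>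
    (-1 : R) ^ Multiset.card S *
      ∑ᶠ α : {p // p ∈ Ψ} → ℕ,
        gg ℓ (fun x =>
          γ x + (∑ p ∈ Ψ.attach, (α p : ℤ) * (eps p.1.1 x - eps p.1.2 x))
            - (S.map fun z => eps z x).sum)).sum

/-- The set of positive roots `Δ_ℓ^+ = {(i,j) : 1 ≤ i < j ≤ ℓ}`. -/
def DeltaPlus (ℓ : ℕ) : Finset (ℕ × ℕ) :=
  (Finset.Icc 1 ℓ ×ˢ Finset.Icc 1 ℓ).filter fun p => p.1 < p.2

/-- A root ideal: an upper order ideal of `Δ_ℓ^+`. -/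
def IsRootIdeal (ℓ : ℕ) (Ψ : Finset (ℕ × ℕ)) : Prop :=
  Ψ ⊆ DeltaPlus ℓ ∧
    ∀ a b c d : ℕ, (a, b) ∈ Ψ → (c, d) ∈ DeltaPlus ℓ → c ≤ a → b ≤ d → (c, d) ∈ Ψ

/-- The root ideal `Δ^k(λ) = {(i,j) ∈ Δ_ℓ^+ : j > k − λ_i + i}`. -/
def DeltaK (k ℓ : ℕ) (lam : ℕ → ℤ) : Finset (ℕ × ℕ) :=
  (DeltaPlus ℓ).filter fun p => (k : ℤ) - lam p.1 + (p.1 : ℤ) < (p.2 : ℤ)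

/-- `bot(Ψ)`: the largest `x` such that row `x` of `Ψ` is nonempty (`0` if `Ψ = ∅`). -/
def botIdeal (Ψ : Finset (ℕ × ℕ)) : ℕ := Ψ.sup Prod.fst

/-- `bot_λ := bot(Δ^k(λ))`. -/
def botL (k ℓ : ℕ) (lam : ℕ → ℤ) : ℕ := botIdeal (DeltaK k ℓ lam)

/-- A removable root of a root ideal. -/
def IsRemovable (ℓ : ℕ) (Ψ : Finset (ℕ × ℕ)) (α : ℕ × ℕ) : Prop :=
  α ∈ Ψ ∧ IsRootIdeal ℓ (Ψ.erase α)

/-- `down_Ψ(x)` is defined, i.e. row `x` of `Ψ` contains a removable root. -/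
def HasDown (ℓ : ℕ) (Ψ : Finset (ℕ × ℕ)) (x : ℕ) : Prop :=
  ∃ j, IsRemovable ℓ Ψ (x, j)

/-- `down_Ψ(x)`: the column of the removable root in row `x` (junk value `0` if
row `x` has no removable root). -/
def down (ℓ : ℕ) (Ψ : Finset (ℕ × ℕ)) (x : ℕ) : ℕ :=
  ((Ψ.filter fun p => p.1 = x ∧ IsRemovable ℓ Ψ p).image Prod.snd).sup id

/-- `down_λ := down_{Δ^k(λ)}`. -/
def downL (k ℓ : ℕ) (lam : ℕ → ℤ) : ℕ → ℕ := down ℓ (DeltaK k ℓ lam)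

/-- The `a`-fold iterate `down_Ψ^a(x)` is defined. -/
def DownIterDefined (ℓ : ℕ) (Ψ : Finset (ℕ × ℕ)) (a x : ℕ) : Prop :=
  ∀ b < a, HasDown ℓ Ψ ((down ℓ Ψ)^[b] x)

/-- `L(ℛ)`: the multiset of second components of `ℛ`, with multiplicity. -/
def Lmul (ℛ : Finset (ℕ × ℕ)) : Multiset ℕ := ℛ.val.map Prod.snd

/-- `λ ∈ P_ℓ^k`: a `k`-bounded partition with `ℓ` parts allowed to be zero. -/
def IsKBounded (k ℓ : ℕ) (lam : ℕ → ℤ) : Prop :=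
  lam 1 ≤ (k : ℤ) ∧ (∀ i, 1 ≤ i → i < ℓ → lam (i + 1) ≤ lam i) ∧ 0 ≤ lam ℓ

/-- The multiset `M_z(λ)`: `L(Δ^k(λ))` with one occurrence of `down_λ(x)` removed
for each `x ∈ [z, bot_λ]`. -/
def Mz (k ℓ : ℕ) (lam : ℕ → ℤ) (z : ℕ) : Multiset ℕ :=
  Lmul (DeltaK k ℓ lam) - ((Finset.Icc z (botL k ℓ lam)).val.map (downL k ℓ lam))

/-- The `K`-`k`-Schur function of weight `z`: `ĝ_λ^{(z)} = K(Δ^k(λ); M_z(λ); λ)`. -/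
def wkschur (k ℓ : ℕ) (lam : ℕ → ℤ) (z : ℕ) : R :=
  katalan ℓ (DeltaK k ℓ lam) (Mz k ℓ lam z) lam

/-- The `K`-`k`-Schur function `g_λ^{(k)} = K(Δ^k(λ); L(Δ^{k+1}(λ)); λ)`. -/
def kkschur (k ℓ : ℕ) (lam : ℕ → ℤ) : R :=
  katalan ℓ (DeltaK k ℓ lam) (Lmul (DeltaK (k + 1) ℓ lam)) lam

/-- The closed `k`-Schur Katalan function `𝔤_λ^{(k)} = K(Δ^k(λ); L(Δ^k(λ)); λ)`. -/
def closedkschur (k ℓ : ℕ) (lam : ℕ → ℤ) : R :=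
  katalan ℓ (DeltaK k ℓ lam) (Lmul (DeltaK k ℓ lam)) lam

/-- `|λ| = λ_1 + ⋯ + λ_ℓ`. -/
def psize (ℓ : ℕ) (lam : ℕ → ℤ) : ℤ := ∑ i ∈ Finset.Icc 1 ℓ, lam i

/-! ### Rows of the determinant -/

theorem hh_of_neg {m : ℤ} (hm : m < 0) : hh m = 0 := by
  funext d
  have h : (d.sum fun _ e => (e : ℤ)) ≠ m := by
    have : 0 ≤ d.sum fun _ e => (e : ℤ) := Finset.sum_nonneg fun _ _ => Int.natCast_nonneg _
    omega
  simp only [hh, if_neg h]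
  rfl

theorem kk_of_neg (r : ℕ) {m : ℤ} (hm : m < 0) : kk r m = 0 := by
  refine Finset.sum_eq_zero fun i _ => ?_
  rw [hh_of_neg (by omega), smul_zero]

theorem kk_succ_sub (r : ℕ) (m : ℤ) : kk (r + 1) m - kk (r + 1) (m - 1) = kk r m := by
  rcases lt_or_ge m 0 with hm | hm
  · rw [kk_of_neg _ hm, kk_of_neg _ hm, kk_of_neg _ (by omega), sub_zero]
  obtain ⟨n, rfl⟩ := Int.eq_ofNat_of_zero_le hm
  have hprev : kk (r + 1) ((n : ℤ) - 1)
      = ∑ i ∈ Finset.range n, ((r + i).choose i : ℚ) • hh ((n : ℤ) - (i + 1 : ℕ)) := by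
    rcases n with _ | n
    · simpa using kk_of_neg (r + 1) (m := -1) (by norm_num)
    · unfold kk
      have hn : (((n + 1 : ℕ) : ℤ) - 1).toNat + 1 = n + 1 := by omega
      rw [hn]
      refine Finset.sum_congr rfl fun i _ => ?_
      rw [show r + 1 + i - 1 = r + i by omega]
      congr 2
      push_cast
      ring
  rw [hprev]
  unfold kk
  rw [Int.toNat_natCast, Finset.sum_range_succ', Finset.sum_range_succ', add_sub_right_comm,
    ← Finset.sum_sub_distrib]
  congr 1
  · refine Finset.sum_congr rfl fun i _ => ?_
    rw [← sub_smul]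
    congr 1
    rw [show r + 1 + (i + 1) - 1 = (r + i) + 1 by omega, show r + (i + 1) - 1 = r + i by omega,
      Nat.choose_succ_succ]
    push_cast
    ring
  · simp

/-- `g_γ` vanishes as soon as some row of its determinant does. -/
theorem gg_eq_zero {ℓ : ℕ} {γ : ℕ → ℤ} {i : ℕ} (hi : i < ℓ) (h : γ (i + 1) + ℓ ≤ i) :
    gg ℓ γ = 0 := by
  refine Matrix.det_eq_zero_of_row_eq_zero ⟨i, hi⟩ fun j => ?_
  have := j.isLt
  exact kk_of_neg _ (by simp only; omega)

/-- The operator `1 - L_{d+1}` applied to `g`. -/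
def ggLowered (ℓ d : ℕ) (γ : ℕ → ℤ) : R := gg ℓ γ - gg ℓ (γ - eps (d + 1))

/-- The dot action of the transposition of the positions `d` and `d + 1`. -/
def dotSwap (d : ℕ) (γ : ℕ → ℤ) : ℕ → ℤ :=
  (γ ∘ Equiv.swap d (d + 1)) + eps (d + 1) - eps d

theorem ggLowered_eq_det {ℓ d : ℕ} (hd : 1 ≤ d) (hdl : d < ℓ) (γ : ℕ → ℤ) :
    ggLowered ℓ d γ = (Matrix.of fun i j : Fin ℓ =>
      kk (if i.val = d then d - 1 else i.val)
        (γ (i.val + 1) + (j.val : ℤ) - (i.val : ℤ))).det := by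
  set A : Matrix (Fin ℓ) (Fin ℓ) R := Matrix.of fun i j : Fin ℓ =>
    kk i.val (γ (i.val + 1) + (j.val : ℤ) - (i.val : ℤ)) with hA
  let r : Fin ℓ := ⟨d, hdl⟩
  let u : Fin ℓ → R := fun j => kk d (γ (d + 1) + (j.val : ℤ) - (d : ℤ))
  let v : Fin ℓ → R := fun j => kk d (γ (d + 1) + (j.val : ℤ) - (d : ℤ) - 1)
  have hu : gg ℓ γ = (A.updateRow r u).det := by
    rw [show A.updateRow r u = A from Matrix.updateRow_eq_self A r]
    rfl
  have hv : gg ℓ (γ - eps (d + 1)) = (A.updateRow r v).det := by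
    unfold gg
    congr 1
    ext1 i j
    by_cases hi : i = r
    · subst hi
      simp [r, v, eps]
      congr 1
      ring
    · have hne : i.val ≠ d := fun h => hi (Fin.ext h)
      simp [hA, Matrix.updateRow_ne hi, eps, hne]
  have hw : (Matrix.of fun i j : Fin ℓ => kk (if i.val = d then d - 1 else i.val)
      (γ (i.val + 1) + (j.val : ℤ) - (i.val : ℤ))) = A.updateRow r (u - v) := by
    ext1 i j
    by_cases hi : i = r
    · subst hi
      obtain ⟨e, rfl⟩ : ∃ e, d = e + 1 := ⟨d - 1, by omega⟩
      simp only [Matrix.of_apply, Matrix.updateRow_self, Pi.sub_apply, r, u, v, if_true]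
      rw [kk_succ_sub]
      simp
    · have hne : i.val ≠ d := fun h => hi (Fin.ext h)
      simp [hA, Matrix.updateRow_ne hi, hne]
  have hadd := Matrix.det_updateRow_add A r (u - v) v
  rw [sub_add_cancel] at hadd
  rw [ggLowered, hw, hu, hv, hadd, add_sub_cancel_right]

theorem ggLowered_dotSwap {ℓ d : ℕ} (hd : 1 ≤ d) (hdl : d < ℓ) (γ : ℕ → ℤ) :
    ggLowered ℓ d (dotSwap d γ) = -ggLowered ℓ d γ := by
  rw [ggLowered_eq_det hd hdl, ggLowered_eq_det hd hdl]
  obtain ⟨e, rfl⟩ : ∃ e, d = e + 1 := ⟨d - 1, by omega⟩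
  let p : Fin ℓ := ⟨e, by omega⟩
  let q : Fin ℓ := ⟨e + 1, hdl⟩
  have hpq : p ≠ q := fun h => by simpa [p, q] using congrArg Fin.val h
  set B : Matrix (Fin ℓ) (Fin ℓ) R := Matrix.of fun i j : Fin ℓ =>
    kk (if i.val = e + 1 then e + 1 - 1 else i.val)
      (γ (i.val + 1) + (j.val : ℤ) - (i.val : ℤ)) with hB
  have hperm := Matrix.det_permute (Equiv.swap p q) B
  rw [Equiv.Perm.sign_swap hpq] at hperm
  have hneg : -B.det = (B.submatrix (Equiv.swap p q) id).det := by rw [hperm]; simp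
  rw [hneg]
  congr 1
  ext1 i j
  by_cases hip : i = p
  · subst hip
    simp [hB, p, q, dotSwap, eps]
    congr 1
    ring
  by_cases hiq : i = q
  · subst hiq
    simp [hB, p, q, dotSwap, eps]
    congr 1
    ring
  have h1 : i.val ≠ e := fun h => hip (Fin.ext h)
  have h2 : i.val ≠ e + 1 := fun h => hiq (Fin.ext h)
  have h3 : Equiv.swap (e + 1) (e + 1 + 1) (i.val + 1) = i.val + 1 :=
    Equiv.swap_apply_of_ne_of_ne (by omega) (by omega)
  simp [hB, Equiv.swap_apply_of_ne_of_ne hip hiq, dotSwap, eps, h1, h2, h3]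

/-! ### Sums over exponents of roots -/

/-- The vector `∑ α(i,j) (ε_i - ε_j)`. -/
def rootWeight (α : ℕ × ℕ →₀ ℕ) : ℕ → ℤ := α.sum fun p n => n • (eps p.1 - eps p.2)

theorem rootWeight_apply (α : ℕ × ℕ →₀ ℕ) (x : ℕ) :
    rootWeight α x = ∑ p ∈ α.support, (α p : ℤ) * (eps p.1 x - eps p.2 x) := by
  simp [rootWeight, Finsupp.sum, Finset.sum_apply]

theorem rootWeight_add_single (α : ℕ × ℕ →₀ ℕ) (β : ℕ × ℕ) :
    rootWeight (α + Finsupp.single β 1) = rootWeight α + (eps β.1 - eps β.2) := by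
  unfold rootWeight
  rw [Finsupp.sum_add_index' (by simp) (by intros; rw [add_smul]), Finsupp.sum_single_index]
  · rw [one_smul]
  · simp

theorem eps_apply_equiv_symm (s : ℕ ≃ ℕ) (i x : ℕ) : eps i (s.symm x) = eps (s i) x := by
  simp only [eps, Equiv.symm_apply_eq]

theorem rootWeight_mapDomain (s : ℕ ≃ ℕ) (α : ℕ × ℕ →₀ ℕ) :
    rootWeight (α.equivMapDomain (s.prodCongr s)) = rootWeight α ∘ s.symm := by
  funext x
  rw [Finsupp.equivMapDomain_eq_mapDomain, rootWeight,
    Finsupp.sum_mapDomain_index (by simp) (by intros; rw [add_smul]), Function.comp_apply,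
    rootWeight_apply]
  simp [Finsupp.sum, Finset.sum_apply, eps_apply_equiv_symm]

theorem sum_mul_eps {ℓ i : ℕ} (c : ℕ → ℤ) (hi : i ∈ Finset.Icc 1 ℓ) :
    ∑ x ∈ Finset.Icc 1 ℓ, c x * eps i x = c i := by
  simp [eps, Finset.mem_Icc.1 hi]

theorem sum_mul_rootWeight {ℓ : ℕ} (c : ℕ → ℤ) {α : ℕ × ℕ →₀ ℕ} (hα : α.support ⊆ DeltaPlus ℓ) :
    ∑ x ∈ Finset.Icc 1 ℓ, c x * rootWeight α x
      = ∑ p ∈ α.support, (α p : ℤ) * (c p.1 - c p.2) := by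
  simp only [rootWeight_apply, Finset.mul_sum]
  rw [Finset.sum_comm]
  refine Finset.sum_congr rfl fun p hp => ?_
  have hp' := hα hp
  simp only [DeltaPlus, Finset.mem_filter, Finset.mem_product] at hp'
  rw [← sum_mul_eps c hp'.1.1, ← sum_mul_eps c hp'.1.2, ← Finset.sum_sub_distrib, Finset.mul_sum]
  exact Finset.sum_congr rfl fun x _ => by ring

/-- Only finitely many exponents of roots contribute to a Katalan function. -/
theorem finite_rootWeight_support {ℓ : ℕ} {Ψ : Finset (ℕ × ℕ)} (hΨ : Ψ ⊆ DeltaPlus ℓ)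
    (γ : ℕ → ℤ) :
    ({α : ℕ × ℕ →₀ ℕ | α.support ⊆ Ψ} ∩
      Function.support fun α => gg ℓ (γ + rootWeight α)).Finite := by
  set C : ℤ := ∑ x ∈ Finset.Icc 1 ℓ, ((x : ℤ) * ℓ + x * γ x) with hC
  refine (Set.finite_Icc (0 : ℕ × ℕ →₀ ℕ) (Finsupp.indicator Ψ fun _ _ => C.toNat)).subset ?_
  rintro α ⟨hα, hg⟩
  have hlow : ∀ x ∈ Finset.Icc 1 ℓ, -(ℓ : ℤ) ≤ γ x + rootWeight α x := by
    intro x hx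
    by_contra hlt
    obtain ⟨i, rfl⟩ : ∃ i, x = i + 1 := ⟨x - 1, by simp at hx; omega⟩
    simp only [Finset.mem_Icc] at hx
    exact hg (gg_eq_zero (i := i) (by omega) (by simp only [Pi.add_apply]; omega))
  have hsum := sum_mul_rootWeight (fun x => -(x : ℤ)) (Finset.Subset.trans hα hΨ)
  have hle : ∑ p ∈ α.support, (α p : ℤ) * (-(p.1 : ℤ) - -(p.2 : ℤ)) ≤ C := by
    rw [← hsum, hC]
    refine Finset.sum_le_sum fun x hx => ?_
    have := mul_nonneg (Int.natCast_nonneg x) (by linarith [hlow x hx] :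
      0 ≤ γ x + rootWeight α x + ℓ)
    linarith
  refine ⟨zero_le, fun p => ?_⟩
  by_cases hp : p ∈ α.support
  · rw [Finsupp.indicator_of_mem (hα hp)]
    have hroot : ∀ q ∈ α.support, (α q : ℤ) ≤ (α q : ℤ) * (-(q.1 : ℤ) - -(q.2 : ℤ)) := by
      intro q hq
      have hq' := hΨ (hα hq)
      simp only [DeltaPlus, Finset.mem_filter] at hq'
      exact le_mul_of_one_le_right (Int.natCast_nonneg _) (by omega)
    have := Finset.single_le_sum (f := fun q => (α q : ℤ) * (-(q.1 : ℤ) - -(q.2 : ℤ)))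
      (fun q hq => (Int.natCast_nonneg _).trans (hroot q hq)) hp
    have := hroot p hp
    omega
  · rw [Finsupp.notMem_support_iff.1 hp]
    exact zero_le

/-- The series `∏_{(i,j) ∈ Ψ} (1 - R_{ij})⁻¹` applied to `F`. -/
def rootSum (Ψ : Finset (ℕ × ℕ)) (F : (ℕ → ℤ) → R) (γ : ℕ → ℤ) : R :=
  ∑ᶠ α ∈ {α : ℕ × ℕ →₀ ℕ | α.support ⊆ Ψ}, F (γ + rootWeight α)

theorem rootSum_eq_finsum (Ψ : Finset (ℕ × ℕ)) (F : (ℕ → ℤ) → R) (γ : ℕ → ℤ) :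
    rootSum Ψ F γ = ∑ᶠ α : {p // p ∈ Ψ} → ℕ,
      F (γ + fun x => ∑ p ∈ Ψ.attach, (α p : ℤ) * (eps p.1.1 x - eps p.1.2 x)) := by
  rw [← finsum_mem_univ, rootSum]
  refine finsum_mem_eq_of_bijOn (fun α p => α p.1) ⟨fun _ _ => trivial, ?_, ?_⟩ ?_
  · intro α hα β hβ h
    ext p
    by_cases hp : p ∈ Ψ
    · exact congrFun h ⟨p, hp⟩
    · rw [Finsupp.notMem_support_iff.1 fun h => hp (hα h),
        Finsupp.notMem_support_iff.1 fun h => hp (hβ h)]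
  · intro α _
    refine ⟨Finsupp.indicator Ψ fun p hp => α ⟨p, hp⟩, Finsupp.support_indicator_subset _ _, ?_⟩
    funext p
    simp [Finsupp.indicator_of_mem p.2]
  · intro α hα
    congr 2
    funext x
    rw [rootWeight_apply, Finset.sum_attach Ψ fun p => (α p : ℤ) * (eps p.1 x - eps p.2 x)]
    exact Finset.sum_subset hα fun p _ hp => by simp [Finsupp.notMem_support_iff.1 hp]

theorem rootSum_insert {ℓ : ℕ} {Ψ : Finset (ℕ × ℕ)} {β : ℕ × ℕ} (hβ : β ∉ Ψ)
    (hΨ : insert β Ψ ⊆ DeltaPlus ℓ) (γ : ℕ → ℤ) :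
    rootSum (insert β Ψ) (gg ℓ) γ
      = rootSum Ψ (gg ℓ) γ + rootSum (insert β Ψ) (gg ℓ) (γ + (eps β.1 - eps β.2)) := by
  set f : (ℕ × ℕ →₀ ℕ) → R := fun α => gg ℓ (γ + rootWeight α) with hf
  set g : (ℕ × ℕ →₀ ℕ) → (ℕ × ℕ →₀ ℕ) := fun α => α + Finsupp.single β 1 with hgdef
  set A : Set (ℕ × ℕ →₀ ℕ) := {α | α.support ⊆ insert β Ψ}
  set A₀ : Set (ℕ × ℕ →₀ ℕ) := {α | α.support ⊆ Ψ}
  have hsplit : A = A₀ ∪ g '' A := by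
    ext α
    constructor
    · intro hα
      by_cases h0 : α β = 0
      · refine Or.inl fun p hp => (Finset.mem_insert.1 (hα hp)).resolve_left ?_
        rintro rfl
        exact Finsupp.mem_support_iff.1 hp h0
      · have hle : Finsupp.single β 1 ≤ α := by
          rw [Finsupp.single_le_iff]
          omega
        exact Or.inr ⟨α - Finsupp.single β 1,
          (Finsupp.support_mono tsub_le_self).trans hα, tsub_add_cancel_of_le hle⟩
    · rintro (h | ⟨δ, hδ, rfl⟩)
      · exact Finset.Subset.trans h (Finset.subset_insert _ _)
      · refine Finsupp.support_add.trans (Finset.union_subset hδ ?_)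
        exact Finsupp.support_single_subset.trans (by simp)
  have hdisj : Disjoint A₀ (g '' A) := by
    rw [Set.disjoint_left]
    rintro _ h ⟨δ, _, rfl⟩
    exact hβ (h (by simp [hgdef]))
  have hfin : (A ∩ Function.support f).Finite := finite_rootWeight_support hΨ γ
  have himage : ∑ᶠ α ∈ g '' A, f α
      = rootSum (insert β Ψ) (gg ℓ) (γ + (eps β.1 - eps β.2)) := by
    rw [finsum_mem_image ((add_left_injective _).injOn), rootSum]
    refine finsum_mem_congr rfl fun α _ => ?_
    simp only [hf, rootWeight_add_single]
    congr 1
    abel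
  rw [← himage, rootSum, rootSum]
  change ∑ᶠ α ∈ A, f α = ∑ᶠ α ∈ A₀, f α + _
  conv_lhs => rw [hsplit]
  have hsub : ∀ B, B ⊆ A₀ ∪ g '' A → (B ∩ Function.support f).Finite := fun B hB =>
    hfin.subset (Set.inter_subset_inter_left _ (hsplit ▸ hB))
  exact finsum_mem_union' hdisj (hsub _ Set.subset_union_left) (hsub _ Set.subset_union_right)

theorem rootSum_ggLowered {ℓ : ℕ} {Ψ : Finset (ℕ × ℕ)} (hΨ : Ψ ⊆ DeltaPlus ℓ) (d : ℕ)
    (γ : ℕ → ℤ) :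
    rootSum Ψ (ggLowered ℓ d) γ
      = rootSum Ψ (gg ℓ) γ - rootSum Ψ (gg ℓ) (γ - eps (d + 1)) := by
  have h2 := finite_rootWeight_support hΨ (γ - eps (d + 1))
  have heq : rootSum Ψ (ggLowered ℓ d) γ + rootSum Ψ (gg ℓ) (γ - eps (d + 1))
      = rootSum Ψ (gg ℓ) γ := by
    unfold rootSum
    rw [← finsum_mem_add_distrib' _ h2]
    · refine finsum_mem_congr rfl fun α _ => ?_
      rw [ggLowered, add_sub_right_comm, sub_add_cancel]
    · refine ((finite_rootWeight_support hΨ γ).union h2).subset ?_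
      rintro α ⟨hα, hne⟩
      by_contra hcon
      simp only [Set.mem_union, Set.mem_inter_iff, hα, true_and, Function.mem_support, not_or,
        not_not] at hcon
      refine hne ?_
      simp only [ggLowered]
      rw [hcon.1, add_sub_right_comm, hcon.2, sub_zero]
  rw [← heq, add_sub_cancel_right]

theorem dotSwap_add (d : ℕ) (γ δ : ℕ → ℤ) :
    dotSwap d (γ + δ) = dotSwap d γ + δ ∘ Equiv.swap d (d + 1) := by
  funext x
  simp only [dotSwap, Pi.add_apply, Pi.sub_apply, Function.comp_apply]
  ring

theorem rootSum_dotSwap {Ψ : Finset (ℕ × ℕ)} {d : ℕ} {F : (ℕ → ℤ) → R}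
    (hF : ∀ γ, F (dotSwap d γ) = -F γ)
    (hΨ : ∀ p, p ∈ Ψ → (Equiv.swap d (d + 1) p.1, Equiv.swap d (d + 1) p.2) ∈ Ψ)
    (γ : ℕ → ℤ) :
    rootSum Ψ F (dotSwap d γ) = -rootSum Ψ F γ := by
  set s := Equiv.swap d (d + 1)
  set e := Finsupp.equivMapDomain (M := ℕ) (s.prodCongr s) with he
  have hmaps : ∀ α : ℕ × ℕ →₀ ℕ, α.support ⊆ Ψ → (e α).support ⊆ Ψ := by
    intro α hα p hp
    have h := hα (show (s.prodCongr s).symm p ∈ α.support by simpa [he] using hp)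
    simpa [s] using hΨ _ h
  have hinv : ∀ α, e (e α) = α := by
    intro α
    ext p
    simp [he, s, Finsupp.equivMapDomain_apply, Prod.map]
  have hbij : Set.BijOn e {α : ℕ × ℕ →₀ ℕ | α.support ⊆ Ψ} {α | α.support ⊆ Ψ} :=
    ⟨hmaps, fun α _ β _ h => by rw [← hinv α, h, hinv],
      fun α hα => ⟨e α, hmaps α hα, hinv α⟩⟩
  have hneg : rootSum Ψ (fun γ => -F γ) γ = -rootSum Ψ F γ := by
    unfold rootSum
    rw [finsum_mem_def, finsum_mem_def, ← finsum_neg_distrib]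
    refine finsum_congr fun α => ?_
    by_cases h : α ∈ {α : ℕ × ℕ →₀ ℕ | α.support ⊆ Ψ} <;> simp [Set.indicator, h]
  rw [← hneg, rootSum, rootSum]
  refine (finsum_mem_eq_of_bijOn e hbij fun α _ => ?_).symm
  rw [he, rootWeight_mapDomain, Equiv.symm_swap, ← dotSwap_add, hF]

/-! ### Lowering operators -/

/-- The product `∏_{z ∈ M} (1 - L_z)` applied to `F`. -/
def lower (M : Multiset ℕ) (F : (ℕ → ℤ) → R) (γ : ℕ → ℤ) : R :=
  (M.powerset.map fun S => (-1 : R) ^ Multiset.card S * F (γ - (S.map eps).sum)).sum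

theorem multiset_sum_eps_apply (S : Multiset ℕ) (x : ℕ) :
    (S.map eps).sum x = (S.map fun z => eps z x).sum := by
  induction S using Multiset.induction_on with
  | empty => simp
  | cons a S ih => simp [ih]

theorem katalan_eq_lower (ℓ : ℕ) (Ψ : Finset (ℕ × ℕ)) (M : Multiset ℕ) (γ : ℕ → ℤ) :
    katalan ℓ Ψ M γ = lower M (rootSum Ψ (gg ℓ)) γ := by
  unfold katalan lower
  congr 1
  refine Multiset.map_congr rfl fun S _ => ?_
  rw [rootSum_eq_finsum]
  congr 2
  funext α
  congr 1
  funext x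
  simp only [Pi.add_apply, Pi.sub_apply, multiset_sum_eps_apply]
  ring

theorem lower_cons (a : ℕ) (M : Multiset ℕ) (F : (ℕ → ℤ) → R) (γ : ℕ → ℤ) :
    lower (a ::ₘ M) F γ = lower M (fun δ => F δ - F (δ - eps a)) γ := by
  unfold lower
  rw [Multiset.powerset_cons, Multiset.map_add, Multiset.sum_add, Multiset.map_map,
    ← Multiset.sum_map_add]
  congr 1
  refine Multiset.map_congr rfl fun S _ => ?_
  rw [Function.comp_apply, Multiset.card_cons, Multiset.map_cons, Multiset.sum_cons, pow_succ,
    show γ - (eps a + (S.map eps).sum) = γ - (S.map eps).sum - eps a by abel]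
  ring

theorem lower_add_shift {F G : (ℕ → ℤ) → R} {δ : ℕ → ℤ} (h : ∀ γ, F γ = G γ + F (γ + δ))
    (M : Multiset ℕ) (γ : ℕ → ℤ) : lower M F γ = lower M G γ + lower M F (γ + δ) := by
  unfold lower
  rw [← Multiset.sum_map_add]
  congr 1
  refine Multiset.map_congr rfl fun S _ => ?_
  rw [h, mul_add, sub_add_eq_add_sub]

theorem powerset_map (f : ℕ → ℕ) (M : Multiset ℕ) :
    (M.map f).powerset = M.powerset.map (Multiset.map f) := by
  induction M using Multiset.induction_on with
  | empty => simp
  | cons a M ih =>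
    rw [Multiset.map_cons, Multiset.powerset_cons, Multiset.powerset_cons, ih, Multiset.map_add,
      Multiset.map_map, Multiset.map_map]
    congr 1
    exact Multiset.map_congr rfl fun S _ => by simp

theorem lower_dotSwap {M : Multiset ℕ} {d : ℕ} {F : (ℕ → ℤ) → R}
    (hF : ∀ γ, F (dotSwap d γ) = -F γ) (hM : M.map (Equiv.swap d (d + 1)) = M) (γ : ℕ → ℤ) :
    lower M F (dotSwap d γ) = -lower M F γ := by
  unfold lower
  conv_lhs => rw [← hM, powerset_map, Multiset.map_map]
  rw [← Multiset.sum_map_neg', Multiset.map_map]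
  congr 1
  refine Multiset.map_congr rfl fun S _ => ?_
  have hS : (((S.map (Equiv.swap d (d + 1))).map eps).sum : ℕ → ℤ)
      = (S.map eps).sum ∘ Equiv.swap d (d + 1) := by
    funext x
    rw [Function.comp_apply, multiset_sum_eps_apply, multiset_sum_eps_apply, Multiset.map_map]
    congr 1
    refine Multiset.map_congr rfl fun z _ => ?_
    rw [Function.comp_apply, ← eps_apply_equiv_symm, Equiv.symm_swap]
  have harg : dotSwap d γ - (S.map eps).sum ∘ Equiv.swap d (d + 1)
      = dotSwap d (γ - (S.map eps).sum) := by
    rw [sub_eq_add_neg γ, dotSwap_add, sub_eq_add_neg]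
    rfl
  simp only [Function.comp_apply]
  rw [hS, Multiset.card_map, harg, hF, mul_neg]

/-! ### Identities between Katalan functions -/

theorem katalan_insert {ℓ : ℕ} {Ψ : Finset (ℕ × ℕ)} {β : ℕ × ℕ} (hβ : β ∉ Ψ)
    (hΨ : insert β Ψ ⊆ DeltaPlus ℓ) (M : Multiset ℕ) (γ : ℕ → ℤ) :
    katalan ℓ (insert β Ψ) M γ
      = katalan ℓ Ψ M γ + katalan ℓ (insert β Ψ) M (γ + (eps β.1 - eps β.2)) := by
  simp only [katalan_eq_lower]
  exact lower_add_shift (rootSum_insert hβ hΨ) M γ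

theorem multiset_map_swap_eq_self {M : Multiset ℕ} {a b : ℕ} (h : M.count a = M.count b) :
    M.map (Equiv.swap a b) = M := by
  ext x
  obtain ⟨y, rfl⟩ := (Equiv.swap a b).surjective x
  rw [Multiset.count_map_eq_count' _ _ (Equiv.swap a b).injective]
  rw [Equiv.swap_apply_def]
  split_ifs with h1 h2
  · rw [h1, h]
  · rw [h2, h]
  · rfl

/-- A Katalan function vanishes if its data are symmetric in the positions `d`, `d + 1` and
its weight is fixed by the dot action of their transposition. -/
theorem katalan_eq_zero_of_symm {ℓ d : ℕ} (hd : 1 ≤ d) (hdl : d < ℓ) {Ψ : Finset (ℕ × ℕ)}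
    (hΨ : Ψ ⊆ DeltaPlus ℓ) (hrow : ∀ j, (d, j) ∈ Ψ ↔ (d + 1, j) ∈ Ψ)
    (hcol : ∀ i < d, (i, d) ∈ Ψ ↔ (i, d + 1) ∈ Ψ) {M : Multiset ℕ}
    (hM : M.count (d + 1) = M.count d + 1) {γ : ℕ → ℤ} (hγ : γ (d + 1) = γ d + 1) :
    katalan ℓ Ψ M γ = 0 := by
  have hlt : ∀ {i j}, (i, j) ∈ Ψ → i < j := fun h => (Finset.mem_filter.1 (hΨ h)).2
  have hmem : d + 1 ∈ M := Multiset.count_pos.1 (by omega)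
  have hswap : (M.erase (d + 1)).map (Equiv.swap d (d + 1)) = M.erase (d + 1) := by
    refine multiset_map_swap_eq_self ?_
    rw [Multiset.count_erase_self, Multiset.count_erase_of_ne (by omega)]
    omega
  have hsymm : ∀ p, p ∈ Ψ → (Equiv.swap d (d + 1) p.1, Equiv.swap d (d + 1) p.2) ∈ Ψ := by
    rintro ⟨i, j⟩ h
    have hij := hlt h
    have hnot : (d, d + 1) ∉ Ψ := fun h => lt_irrefl _ (hlt ((hrow _).1 h))
    simp only [Equiv.swap_apply_def]
    grind
  have hfix : dotSwap d γ = γ := by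
    funext x
    simp only [dotSwap, eps, Pi.add_apply, Pi.sub_apply, Function.comp_apply,
      Equiv.swap_apply_def]
    split_ifs <;> subst_vars <;> omega
  have hfun : (fun δ => rootSum Ψ (gg ℓ) δ - rootSum Ψ (gg ℓ) (δ - eps (d + 1)))
      = rootSum Ψ (ggLowered ℓ d) := funext fun δ => (rootSum_ggLowered hΨ d δ).symm
  rw [katalan_eq_lower, ← Multiset.cons_erase hmem, lower_cons, hfun]
  have key := lower_dotSwap (rootSum_dotSwap (ggLowered_dotSwap hd hdl) hsymm) hswap γ
  rw [hfix] at key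
  funext m
  have hm : lower (M.erase (d + 1)) (rootSum Ψ (ggLowered ℓ d)) γ m
      = -(lower (M.erase (d + 1)) (rootSum Ψ (ggLowered ℓ d)) γ m) := congrFun key m
  exact self_eq_neg.1 hm

/-! ### The root ideal of a bounded partition -/

theorem mem_DeltaPlus {ℓ i j : ℕ} : (i, j) ∈ DeltaPlus ℓ ↔ 1 ≤ i ∧ i < j ∧ j ≤ ℓ := by
  simp only [DeltaPlus, Finset.mem_filter, Finset.mem_product, Finset.mem_Icc]
  omega

theorem mem_DeltaK {k ℓ : ℕ} {lam : ℕ → ℤ} {i j : ℕ} :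
    (i, j) ∈ DeltaK k ℓ lam ↔ (1 ≤ i ∧ i < j ∧ j ≤ ℓ) ∧ (k : ℤ) - lam i + i < j := by
  rw [DeltaK, Finset.mem_filter, mem_DeltaPlus]

theorem DeltaK_subset (k ℓ : ℕ) (lam : ℕ → ℤ) : DeltaK k ℓ lam ⊆ DeltaPlus ℓ :=
  Finset.filter_subset _ _

theorem le_botL {k ℓ : ℕ} {lam : ℕ → ℤ} {i j : ℕ} (h : (i, j) ∈ DeltaK k ℓ lam) :
    i ≤ botL k ℓ lam :=
  Finset.le_sup (f := Prod.fst) h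

namespace IsKBounded

variable {k ℓ : ℕ} {lam : ℕ → ℤ}

theorem antitone (hlam : IsKBounded k ℓ lam) {i j : ℕ} (hi : 1 ≤ i) (hij : i ≤ j) (hj : j ≤ ℓ) :
    lam j ≤ lam i := by
  induction j, hij using Nat.le_induction with
  | base => exact le_rfl
  | succ j hij ih => exact (hlam.2.1 j (by omega) (by omega)).trans (ih (by omega))

theorem le (hlam : IsKBounded k ℓ lam) {i : ℕ} (hi : 1 ≤ i) (hil : i ≤ ℓ) : lam i ≤ k :=
  (hlam.antitone le_rfl hi hil).trans hlam.1

theorem isRemovable_iff (hlam : IsKBounded k ℓ lam) {x j : ℕ} :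
    IsRemovable ℓ (DeltaK k ℓ lam) (x, j) ↔
      (x, j) ∈ DeltaK k ℓ lam ∧ (j : ℤ) = k - lam x + x + 1 := by
  refine and_congr_right fun hmem => ?_
  have hxj := mem_DeltaK.1 hmem
  constructor
  · intro hid
    by_contra hne
    have hk := hlam.le (i := x) (by omega) (by omega)
    have hleft : (x, j - 1) ∈ (DeltaK k ℓ lam).erase (x, j) := by
      rw [Finset.mem_erase, mem_DeltaK]
      refine ⟨fun h => ?_, by omega⟩
      have := (Prod.mk.inj h).2
      omega
    exact Finset.notMem_erase _ _ (hid.2 _ _ _ _ hleft (DeltaK_subset _ _ _ hmem) le_rfl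
      (Nat.sub_le _ _))
  · refine fun hj => ⟨(Finset.erase_subset _ _).trans (DeltaK_subset _ _ _), ?_⟩
    intro a b c d hab hcd hca hbd
    rw [Finset.mem_erase, mem_DeltaK] at hab ⊢
    rw [mem_DeltaPlus] at hcd
    have hac := hlam.antitone hcd.1 hca (by omega)
    refine ⟨fun h => hab.1 ?_, hcd, by omega⟩
    obtain ⟨rfl, rfl⟩ := Prod.mk.inj h
    rw [Prod.mk.injEq]
    omega

theorem downL_eq (hlam : IsKBounded k ℓ lam) {x j : ℕ} (hmem : (x, j) ∈ DeltaK k ℓ lam)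
    (hj : (j : ℤ) = k - lam x + x + 1) : downL k ℓ lam x = j := by
  have hrem := hlam.isRemovable_iff.2 ⟨hmem, hj⟩
  refine le_antisymm (Finset.sup_le fun y hy => ?_)
    (Finset.le_sup (f := id) (Finset.mem_image.2 ⟨(x, j), by simp [hmem, hrem], rfl⟩))
  obtain ⟨⟨x', y⟩, hp, rfl⟩ := Finset.mem_image.1 hy
  obtain ⟨-, rfl, hrem'⟩ := Finset.mem_filter.1 hp
  have := (hlam.isRemovable_iff.1 hrem').2
  dsimp only [id] at hj this ⊢
  omega

theorem downL_spec (hlam : IsKBounded k ℓ lam) {x : ℕ} (h : downL k ℓ lam x ≠ 0) :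
    (x, downL k ℓ lam x) ∈ DeltaK k ℓ lam ∧ (downL k ℓ lam x : ℤ) = k - lam x + x + 1 := by
  set T := ((DeltaK k ℓ lam).filter fun p => p.1 = x ∧ IsRemovable ℓ (DeltaK k ℓ lam) p).image
    Prod.snd
  have hne : T.Nonempty := by
    rw [Finset.nonempty_iff_ne_empty]
    intro h0
    refine h ?_
    change T.sup id = 0
    rw [h0]
    rfl
  obtain ⟨j, hj⟩ := hne
  obtain ⟨⟨x', y⟩, hp, rfl⟩ := Finset.mem_image.1 hj
  obtain ⟨-, rfl, hrem⟩ := Finset.mem_filter.1 hp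
  have hrem' := hlam.isRemovable_iff.1 hrem
  rw [hlam.downL_eq hrem'.1 hrem'.2]
  exact hrem'

/-- The column of the removable root in row `y` has height `y`. -/
theorem mem_column_down (hlam : IsKBounded k ℓ lam) {y d : ℕ} (hmem : (y, d) ∈ DeltaK k ℓ lam)
    (hd : (d : ℤ) = k - lam y + y + 1) {i : ℕ} : (i, d) ∈ DeltaK k ℓ lam ↔ 1 ≤ i ∧ i ≤ y := by
  have hy := mem_DeltaK.1 hmem
  rw [mem_DeltaK]
  constructor
  · intro h
    refine ⟨h.1.1, ?_⟩
    by_contra hlt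
    have := hlam.antitone hy.1.1 (by omega : y ≤ i) (by omega)
    omega
  · intro h
    have := hlam.antitone h.1 h.2 (by omega)
    omega

theorem mem_column_down_succ (hlam : IsKBounded k ℓ lam) {y d : ℕ}
    (hmem : (y, d) ∈ DeltaK k ℓ lam) (hd : (d : ℤ) = k - lam y + y + 1) (hdl : d < ℓ) {i : ℕ}
    (hi : i ≠ y + 1) : (i, d + 1) ∈ DeltaK k ℓ lam ↔ 1 ≤ i ∧ i ≤ y := by
  have hy := mem_DeltaK.1 hmem
  rw [mem_DeltaK]
  constructor
  · intro h
    refine ⟨h.1.1, ?_⟩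
    by_contra hlt
    have := hlam.antitone hy.1.1 (by omega : y ≤ i) (by omega)
    omega
  · intro h
    have := hlam.antitone h.1 h.2 (by omega)
    omega

end IsKBounded

theorem count_Lmul {Ψ : Finset (ℕ × ℕ)} {c n : ℕ} (h : ∀ i, (i, c) ∈ Ψ ↔ 1 ≤ i ∧ i ≤ n) :
    (Lmul Ψ).count c = n := by
  rw [Lmul, Multiset.count_map]
  change (Ψ.filter fun p => c = p.2).card = n
  have : (Ψ.filter fun p => c = p.2) = (Finset.Icc 1 n).image fun i => (i, c) := by
    ext ⟨i, j⟩
    simp only [Finset.mem_filter, Finset.mem_image, Finset.mem_Icc, Prod.mk.injEq]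
    constructor
    · rintro ⟨hm, rfl⟩
      exact ⟨i, (h i).1 hm, rfl, rfl⟩
    · rintro ⟨_, hi, rfl, rfl⟩
      exact ⟨(h _).2 hi, rfl⟩
  rw [this, Finset.card_image_of_injective _ fun i j hij => (Prod.mk.inj hij).1]
  simp

theorem count_map_eq_one {s : Finset ℕ} {f : ℕ → ℕ} {y : ℕ} (hy : y ∈ s)
    (h : ∀ x ∈ s, f x = f y → x = y) : (s.val.map f).count (f y) = 1 := by
  rw [Multiset.count_map]
  change (s.filter fun x => f y = f x).card = 1
  rw [Finset.card_eq_one]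
  refine ⟨y, Finset.ext fun x => ?_⟩
  simp only [Finset.mem_filter, Finset.mem_singleton]
  exact ⟨fun hx => h x hx.1 hx.2.symm, by rintro rfl; exact ⟨hy, rfl⟩⟩

theorem IsKBounded.count_Mz_succ {k ℓ : ℕ} {lam : ℕ → ℤ} (hlam : IsKBounded k ℓ lam) {z y d : ℕ}
    (hzy : z ≤ y) (hmem : (y, d) ∈ DeltaK k ℓ lam) (hd : (d : ℤ) = k - lam y + y + 1)
    (hdl : d < ℓ) : (Mz k ℓ lam z).count (d + 1) = (Mz k ℓ lam z).count d + 1 := by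
  have hy := mem_DeltaK.1 hmem
  have hinj : ∀ x x', downL k ℓ lam x = downL k ℓ lam x' → downL k ℓ lam x' ≠ 0 → x = x' := by
    intro x x' h h0
    obtain ⟨h1, h2⟩ := hlam.downL_spec h0
    obtain ⟨h3, h4⟩ := hlam.downL_spec (h ▸ h0)
    rw [h] at h3
    have := (hlam.mem_column_down h1 h2).1 h3
    rw [← h] at h1
    have := (hlam.mem_column_down (h ▸ h3) h4).1 h1
    omega
  have hone : ∀ {x c}, (x, c) ∈ DeltaK k ℓ lam → (c : ℤ) = k - lam x + x + 1 → z ≤ x →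
      ((Finset.Icc z (botL k ℓ lam)).val.map (downL k ℓ lam)).count c = 1 := by
    intro x c hm hc hzx
    have hdown := hlam.downL_eq hm hc
    rw [← hdown]
    refine count_map_eq_one (Finset.mem_Icc.2 ⟨hzx, le_botL hm⟩) fun x' _ h => hinj _ _ h ?_
    have := mem_DeltaK.1 hm
    omega
  rw [Mz, Multiset.count_sub, Multiset.count_sub, hone hmem hd hzy,
    count_Lmul fun i => hlam.mem_column_down hmem hd]
  by_cases hs : (y + 1, d + 1) ∈ DeltaK k ℓ lam
  · have hs' := mem_DeltaK.1 hs
    have := hlam.antitone hy.1.1 (Nat.le_succ y) (by omega)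
    have hd' : ((d + 1 : ℕ) : ℤ) = k - lam (y + 1) + (y + 1 : ℕ) + 1 := by
      simp only [Nat.succ_eq_add_one] at this
      omega
    rw [hone hs hd' (by omega), count_Lmul fun i => hlam.mem_column_down hs hd']
    omega
  · rw [count_Lmul (c := d + 1) (n := y) fun i => ?_, Multiset.count_eq_zero_of_notMem]
    · omega
    · intro hm
      obtain ⟨x, -, hx⟩ := Multiset.mem_map.1 hm
      obtain ⟨h1, h2⟩ := hlam.downL_spec (x := x) (by omega)
      rw [hx] at h1 h2
      have hxy := fun i => hlam.mem_column_down (i := i) h1 h2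
      have h3 := (hxy y).1 ((hlam.mem_column_down_succ hmem hd hdl (by omega)).2 ⟨hy.1.1, le_rfl⟩)
      have h4 : ¬ y + 1 ≤ x := fun h => hs ((hxy (y + 1)).2 ⟨by omega, h⟩)
      have : x = y := by omega
      subst this
      omega
    · by_cases hi : i = y + 1
      · subst hi
        simp [hs]
      · exact hlam.mem_column_down_succ hmem hd hdl hi

/-- The vanishing at `d = down y` when the columns `d` and `d + 1` have the same height. -/
theorem IsKBounded.katalan_eq_zero_of_ceiling {k ℓ : ℕ} {lam : ℕ → ℤ}
    (hlam : IsKBounded k ℓ lam) {z y d : ℕ}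
    (hzy : z ≤ y) (hmem : (y, d) ∈ DeltaK k ℓ lam) (hd : (d : ℤ) = k - lam y + y + 1)
    (hdl : d < ℓ) (hceil : (y + 1, d + 1) ∉ DeltaK k ℓ lam) {Ψ : Finset (ℕ × ℕ)}
    (hΨ : Ψ ⊆ DeltaPlus ℓ) (hlow : ∀ i < d, ∀ j, (i, j) ∈ Ψ ↔ (i, j) ∈ DeltaK k ℓ lam)
    (hwall : ∀ j, (d, j) ∈ Ψ ↔ (d + 1, j) ∈ Ψ) {γ : ℕ → ℤ} (hγ : γ (d + 1) = γ d + 1) :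
    katalan ℓ Ψ (Mz k ℓ lam z) γ = 0 := by
  have hy := mem_DeltaK.1 hmem
  refine katalan_eq_zero_of_symm (by omega) hdl hΨ hwall (fun i hi => ?_)
    (hlam.count_Mz_succ hzy hmem hd hdl) hγ
  rw [hlow i hi, hlow i hi, hlam.mem_column_down hmem hd]
  by_cases h : i = y + 1
  · subst h
    simp [hceil]
  · rw [hlam.mem_column_down_succ hmem hd hdl h]

/-- One step of the mirror argument: the position `d = down y` is traded for `y`. -/
theorem IsKBounded.katalan_mirror {k ℓ : ℕ} {lam : ℕ → ℤ} (hlam : IsKBounded k ℓ lam) {z y d : ℕ}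
    (hzy : z ≤ y) (hyd : y + 1 < d) (hmem : (y, d) ∈ DeltaK k ℓ lam)
    (hd : (d : ℤ) = k - lam y + y + 1) (hdl : d < ℓ) (hmem' : (y + 1, d + 1) ∈ DeltaK k ℓ lam)
    {Ψ : Finset (ℕ × ℕ)} (hΨ : Ψ ⊆ DeltaPlus ℓ)
    (hlow : ∀ i < d, ∀ j, (i, j) ∈ Ψ ↔ (i, j) ∈ DeltaK k ℓ lam)
    (hwall : ∀ j, (d, j) ∈ Ψ ↔ (d + 1, j) ∈ Ψ) {γ : ℕ → ℤ} (hγ : γ (d + 1) = γ d + 1) :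
    katalan ℓ Ψ (Mz k ℓ lam z) γ = katalan ℓ (insert (y + 1, d) Ψ) (Mz k ℓ lam z)
      (γ + (eps (y + 1) - eps (d + 1))) := by
  have hy := mem_DeltaK.1 hmem
  have hM := hlam.count_Mz_succ hzy hmem hd hdl
  have hcol : ∀ i < d, (i, d) ∈ Ψ ↔ 1 ≤ i ∧ i ≤ y := fun i hi => by
    rw [hlow i hi, hlam.mem_column_down hmem hd]
  have hcol' : ∀ i < d, i ≠ y + 1 → ((i, d + 1) ∈ Ψ ↔ 1 ≤ i ∧ i ≤ y) := fun i hi h => by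
    rw [hlow i hi, hlam.mem_column_down_succ hmem hd hdl h]
  have hmemΨ : (y + 1, d + 1) ∈ Ψ := (hlow _ hyd _).2 hmem'
  have hnot : (y + 1, d) ∉ Ψ := fun h => by
    have := (hcol _ hyd).1 h
    omega
  have hΨ' : insert (y + 1, d) Ψ ⊆ DeltaPlus ℓ :=
    Finset.insert_subset (mem_DeltaPlus.2 ⟨by omega, hyd, by omega⟩) hΨ
  have hremove := katalan_insert (β := (y + 1, d + 1)) (Finset.notMem_erase _ Ψ)
    (by rwa [Finset.insert_erase hmemΨ]) (Mz k ℓ lam z) γ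
  rw [Finset.insert_erase hmemΨ] at hremove
  have hzero : katalan ℓ (Ψ.erase (y + 1, d + 1)) (Mz k ℓ lam z) γ = 0 := by
    refine katalan_eq_zero_of_symm (by omega) hdl ((Finset.erase_subset _ _).trans hΨ)
      (fun j => ?_) (fun i hi => ?_) hM hγ
    · have h1 : d ≠ y + 1 := by omega
      have h2 : d ≠ y := by omega
      simp [h1, h2, hwall j]
    · by_cases h : i = y + 1
      · subst h
        simp [hnot]
      · simp [h, hcol i hi, hcol' i hi h]
  have hinsert := katalan_insert hnot hΨ' (Mz k ℓ lam z) (γ + (eps (y + 1) - eps (d + 1)))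
  have hzero' : katalan ℓ (insert (y + 1, d) Ψ) (Mz k ℓ lam z)
      (γ + (eps (y + 1) - eps (d + 1)) + (eps (y + 1) - eps d)) = 0 := by
    refine katalan_eq_zero_of_symm (by omega) hdl hΨ' (fun j => ?_) (fun i hi => ?_) hM ?_
    · have h1 : d ≠ y + 1 := by omega
      have h2 : d ≠ y := by omega
      simp [h1, h2, hwall j]
    · by_cases h : i = y + 1
      · subst h
        simp [hmemΨ]
      · simp [h, hcol i hi, hcol' i hi h]
    · have h1 : d ≠ y + 1 := by omega
      have h2 : d ≠ y := by omega
      simp [eps, h1, h2, hγ]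
  rw [hremove, hzero, zero_add, hinsert, hzero', add_zero]

theorem IsKBounded.le_iterate_downL {k ℓ : ℕ} {lam : ℕ → ℤ} (hlam : IsKBounded k ℓ lam) {z : ℕ}
    (n : ℕ) (h : (downL k ℓ lam)^[n] z ≠ 0) : z ≤ (downL k ℓ lam)^[n] z := by
  induction n with
  | zero => exact le_rfl
  | succ n ih =>
    rw [Function.iterate_succ_apply'] at h ⊢
    have hx := mem_DeltaK.1 (hlam.downL_spec h).1
    have := ih (by omega)
    omega

/-- The vanishing along the chain of iterates of `down` starting in a row `z` that is strictly
longer than the next one. -/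
theorem IsKBounded.katalan_eq_zero_of_chain {k ℓ : ℕ} {lam : ℕ → ℤ}
    (hlam : IsKBounded k ℓ lam) {z : ℕ}
    (hz1 : 1 ≤ z) (hstrict : lam (z + 1) < lam z) (n : ℕ) {y d : ℕ}
    (hchain : (downL k ℓ lam)^[n] z = y) (hdown : downL k ℓ lam y = d) (hd0 : d ≠ 0) (hdl : d < ℓ) {Ψ : Finset (ℕ × ℕ)}
    (hΨ : Ψ ⊆ DeltaPlus ℓ) (hlow : ∀ i < d, ∀ j, (i, j) ∈ Ψ ↔ (i, j) ∈ DeltaK k ℓ lam)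
    (hwall : ∀ j, (d, j) ∈ Ψ ↔ (d + 1, j) ∈ Ψ) {γ : ℕ → ℤ} (hγ : γ (d + 1) = γ d + 1)
    (hγlow : ∀ i < d, γ i = lam i) :
    katalan ℓ Ψ (Mz k ℓ lam z) γ = 0 := by
  induction n generalizing y d Ψ γ with
  | zero =>
    obtain rfl : z = y := hchain
    subst hdown
    obtain ⟨hmem, hd⟩ := hlam.downL_spec hd0
    refine hlam.katalan_eq_zero_of_ceiling le_rfl hmem hd hdl (fun h => ?_) hΨ hlow hwall hγ
    have := mem_DeltaK.1 h
    omega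
  | succ n ih =>
    subst hdown
    obtain ⟨hmem, hd⟩ := hlam.downL_spec hd0
    set d := downL k ℓ lam y
    have hy := mem_DeltaK.1 hmem
    have hzy : z ≤ y := hchain ▸ hlam.le_iterate_downL (n + 1) (by omega)
    by_cases hceil : (y + 1, d + 1) ∈ DeltaK k ℓ lam
    · rw [Function.iterate_succ_apply'] at hchain
      set x := (downL k ℓ lam)^[n] z with hx
      have hxy := mem_DeltaK.1 (hlam.downL_spec (x := x) (by omega)).1
      have hzx : z ≤ x := hlam.le_iterate_downL n (by omega)
      have hs := mem_DeltaK.1 hceil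
      have hlt : lam y < k := by
        have h1 := hlam.antitone (by omega : 1 ≤ z + 1) (by omega : z + 1 ≤ y) (by omega)
        have h2 := hlam.le hz1 (by omega : z ≤ ℓ)
        omega
      have heq : lam (y + 1) = lam y :=
        le_antisymm (hlam.antitone hy.1.1 (Nat.le_succ y) (by omega)) (by omega)
      have hyd : y + 1 < d := by omega
      rw [hlam.katalan_mirror hzy hyd hmem hd hdl hceil hΨ hlow hwall hγ]
      refine ih hx.symm hchain (by omega) (by omega)
        (Finset.insert_subset (mem_DeltaPlus.2 ⟨by omega, hyd, by omega⟩) hΨ) ?_ ?_ ?_ ?_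
      · intro i hi j
        have : i ≠ y + 1 := by omega
        simp [this, hlow i (by omega) j]
      · intro j
        simp only [Finset.mem_insert, Prod.mk.injEq, hlow y (by omega), hlow (y + 1) hyd,
          mem_DeltaK, true_and]
        omega
      · have h1 : y ≠ d := by omega
        have h2 : y ≠ d + 1 := by omega
        simp [eps, h1, h2, hγlow y (by omega), hγlow (y + 1) hyd, heq]
      · intro i hi
        have h1 : i ≠ y + 1 := by omega
        have h2 : i ≠ d + 1 := by omega
        simp [eps, h1, h2, hγlow i (by omega)]
    · exact hlam.katalan_eq_zero_of_ceiling hzy hmem hd hdl hceil hΨ hlow hwall hγ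

/-- A Katalan function vanishes if the last entry of its weight is negative. -/
theorem katalan_eq_zero_of_last_neg {ℓ : ℕ} (hℓ : 1 ≤ ℓ) {Ψ : Finset (ℕ × ℕ)}
    (hΨ : Ψ ⊆ DeltaPlus ℓ) (M : Multiset ℕ) {γ : ℕ → ℤ} (hγ : γ ℓ < 0) :
    katalan ℓ Ψ M γ = 0 := by
  have hroot : ∀ δ : ℕ → ℤ, δ ℓ < 0 → rootSum Ψ (gg ℓ) δ = 0 := by
    intro δ hδ
    refine finsum_mem_of_eqOn_zero fun α hα => ?_
    have hweight : rootWeight α ℓ ≤ 0 := by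
      rw [rootWeight_apply]
      refine Finset.sum_nonpos fun p hp => ?_
      have hp' := mem_DeltaPlus.1 (hΨ (hα hp))
      have h1 : ℓ ≠ p.1 := by omega
      refine mul_nonpos_of_nonneg_of_nonpos (Int.natCast_nonneg _) ?_
      simp only [eps, if_neg h1]
      split_ifs <;> norm_num
    refine gg_eq_zero (i := ℓ - 1) (by omega) ?_
    rw [Nat.sub_add_cancel hℓ, Pi.add_apply]
    omega
  rw [katalan_eq_lower, lower]
  refine Multiset.sum_eq_zero fun x hx => ?_
  obtain ⟨S, -, rfl⟩ := Multiset.mem_map.1 hx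
  have hS : 0 ≤ (S.map eps).sum ℓ := by
    rw [multiset_sum_eps_apply]
    refine Multiset.sum_nonneg fun x hx => ?_
    obtain ⟨i, -, rfl⟩ := Multiset.mem_map.1 hx
    simp only [eps]
    split_ifs <;> norm_num
  rw [hroot _ (by rw [Pi.sub_apply]; omega), mul_zero]

/-- lowering at `d = down_λ^a(z) ∈ [bot_λ+1, ℓ]` vanishes when
`γ = λ − ε_d ∉ P_ℓ^k` (with `λ_z > λ_{z+1}` in case `down_λ^{a−1}(z) ∈ [bot_λ − 1]`). -/
theorem statement6 (k ℓ : ℕ) (hℓ : 1 ≤ ℓ) (lam : ℕ → ℤ) (hlam : IsKBounded k ℓ lam)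
    (z : ℕ) (hz : z ∈ Finset.Icc 1 (botL k ℓ lam)) (a : ℕ) (ha : 1 ≤ a)
    (h1 : (downL k ℓ lam)^[a - 1] z ∈ Finset.Icc 1 (botL k ℓ lam))
    (h2 : (downL k ℓ lam)^[a] z ∈ Finset.Icc (botL k ℓ lam + 1) ℓ)
    (hγ : ¬ IsKBounded k ℓ (lam - eps ((downL k ℓ lam)^[a] z)))
    (hstrict : (downL k ℓ lam)^[a - 1] z ∈ Finset.Icc 1 (botL k ℓ lam - 1) →
      lam (z + 1) < lam z) :
    katalan ℓ (DeltaK k ℓ lam) (Mz k ℓ lam z) (lam - eps ((downL k ℓ lam)^[a] z)) = 0 := by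
  obtain ⟨hz1, -⟩ := Finset.mem_Icc.1 hz
  obtain ⟨n, rfl⟩ : ∃ n, a = n + 1 := ⟨a - 1, by omega⟩
  rw [Nat.add_sub_cancel] at h1 hstrict
  rw [Function.iterate_succ_apply'] at h2 hγ ⊢
  obtain ⟨y, hy⟩ : ∃ y, (downL k ℓ lam)^[n] z = y := ⟨_, rfl⟩
  obtain ⟨d, hdown⟩ : ∃ d, downL k ℓ lam y = d := ⟨_, rfl⟩
  rw [hy] at h1 hstrict
  rw [hy, hdown] at h2 hγ ⊢
  rw [Finset.mem_Icc] at h1 h2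
  have hspec := hlam.downL_spec (x := y) (by omega)
  rw [hdown] at hspec
  obtain ⟨hmem, hd⟩ := hspec
  have hzy : z ≤ y := hy ▸ hlam.le_iterate_downL n (by omega)
  by_cases hlast : (lam - eps d) ℓ < 0
  · exact katalan_eq_zero_of_last_neg hℓ (DeltaK_subset _ _ _) _ hlast
  have hflat : d < ℓ ∧ lam (d + 1) = lam d := by
    by_contra hcon
    refine hγ ⟨?_, fun i hi hil => ?_, not_lt.1 hlast⟩
    · have h := hlam.1
      simp only [Pi.sub_apply, eps]
      split_ifs <;> omega
    · have h := hlam.2.1 i hi hil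
      by_cases hid : i = d
      · subst hid
        have : lam (i + 1) ≠ lam i := fun h => hcon ⟨hil, h⟩
        simp only [Pi.sub_apply, eps, Nat.succ_ne_self, if_true, if_false]
        omega
      · simp only [Pi.sub_apply, eps, if_neg hid]
        split_ifs <;> omega
  have hwall : ∀ j, (d, j) ∈ DeltaK k ℓ lam ↔ (d + 1, j) ∈ DeltaK k ℓ lam := by
    refine fun j => iff_of_false (fun h => ?_) fun h => ?_ <;>
    · have := le_botL h
      omega
  have hweight : (lam - eps d) (d + 1) = (lam - eps d) d + 1 := by
    simp [eps, hflat.2]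
  by_cases hbot : y = botL k ℓ lam
  · refine hlam.katalan_eq_zero_of_ceiling hzy hmem hd hflat.1 (fun h => ?_)
      (DeltaK_subset _ _ _) (fun _ _ _ => Iff.rfl) hwall hweight
    have := le_botL h
    omega
  · refine hlam.katalan_eq_zero_of_chain hz1 (hstrict (Finset.mem_Icc.2 (by omega))) n hy hdown
      (by omega) hflat.1 (DeltaK_subset _ _ _) (fun _ _ _ => Iff.rfl) hwall hweight
      fun i hi => ?_
    simp [eps, hi.ne]

end
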